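/- Let q ∈ ℂ with 0 < |q| < 1, let a ∈ ℂ with a ≠ 0, let k be a positive integer, and let g : ℂ × ℂ → ℂ (or matrix-valued). Fix z ≠ 0 and set c(w) := 1/(a w^k). Assume the series (1−q)∑_{j≥0} c(z)q^j g(z, c(z)q^j) and (1−q)∑_{j≥0} c(z)q^j g(qz, c(z)q^j) converge absolutely. Then D_q( F )(z) = ∫₀^{c(z)} D_{q,z} g(z, u) d_q u − ∑_{j=0}^{k−1} (q^{j−k}/(a z^{k+1})) · g(qz, q^{j−k}/(a z^k)), where F(w) := ∫₀^{c(w)} g(w, u) d_q u, D_q F(z) := (F(z) − F(qz))/((1−q)z), and D_{q,z} g(z,u) := (g(z,u) − g(qz,u))/((1−q)z). -/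

import Mathlib

/- STATEMENT 19: the q-derivative of a Jackson q-integral with variable upper limit
   1/(a z^k):
   D_q(∫₀^{1/(az^k)} g(z,u) d_q u)
     = ∫₀^{1/(az^k)} D_{q,z} g(z,u) d_q u
       − ∑_{j=0}^{k−1} (q^{j−k}/(a z^{k+1})) g(qz, q^{j−k}/(a z^k)). -/

noncomputable section

/-- Upper limit `c(w) = 1/(a w^k)` of the Jackson q-integral. -/
def climit (a : ℂ) (k : ℕ) (w : ℂ) : ℂ := (a * w ^ k)⁻¹

/-- The Jackson q-integral `F(w) = ∫₀^{c(w)} g(w,u) d_q u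
    = (1−q) ∑_{j≥0} c(w) q^j g(w, c(w) q^j)`. -/
def jackF (q a : ℂ) (k : ℕ) (g : ℂ → ℂ → ℂ) (w : ℂ) : ℂ :=
  (1 - q) * ∑' j : ℕ, climit a k w * q ^ j * g w (climit a k w * q ^ j)

theorem climit_mul (q a : ℂ) (k : ℕ) (z : ℂ) :
    climit a k (q * z) = climit a k z * (q ^ k)⁻¹ := by
  simp only [climit, mul_pow, mul_inv]
  ring

theorem climit_mul_mul_pow_add {q : ℂ} (hq : q ≠ 0) (a : ℂ) (k : ℕ) (z : ℂ) (j : ℕ) :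
    climit a k (q * z) * q ^ (j + k) = climit a k z * q ^ j := by
  rw [climit_mul, pow_add]
  field_simp

theorem climit_mul_mul_pow {q : ℂ} (hq : q ≠ 0) (a : ℂ) (k : ℕ) (z : ℂ) (j : ℕ) :
    climit a k (q * z) * q ^ j = q ^ ((j : ℤ) - (k : ℤ)) / (a * z ^ k) := by
  rw [climit_mul, zpow_sub₀ hq, zpow_natCast, zpow_natCast, climit]
  ring

/-- Splitting off the first `k` terms of the Jackson integral at `q * z` leaves an integral with
the upper limit `climit a k z`. -/
theorem jackF_mul {q : ℂ} (hq : q ≠ 0) (a : ℂ) (k : ℕ) (g : ℂ → ℂ → ℂ) (z : ℂ)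
    (h : Summable fun j : ℕ => climit a k z * q ^ j * g (q * z) (climit a k z * q ^ j)) :
    jackF q a k g (q * z) = (1 - q) *
      (∑ j ∈ Finset.range k, q ^ ((j : ℤ) - (k : ℤ)) / (a * z ^ k) *
          g (q * z) (q ^ ((j : ℤ) - (k : ℤ)) / (a * z ^ k)) +
        ∑' j : ℕ, climit a k z * q ^ j * g (q * z) (climit a k z * q ^ j)) := by
  have hs : Summable fun j : ℕ =>
      climit a k (q * z) * q ^ j * g (q * z) (climit a k (q * z) * q ^ j) := by
    rw [← summable_nat_add_iff k]
    simpa only [climit_mul_mul_pow_add hq] using h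
  rw [jackF, ← hs.sum_add_tsum_nat_add k]
  simp only [climit_mul_mul_pow_add hq]
  simp only [climit_mul_mul_pow hq]

theorem stmt_19 (q : ℂ) (hq0 : 0 < ‖q‖) (hq1 : ‖q‖ < 1)
    (a : ℂ) (ha : a ≠ 0) (k : ℕ) (hk : 0 < k)
    (g : ℂ → ℂ → ℂ) (z : ℂ) (hz : z ≠ 0)
    (h1 : Summable fun j : ℕ =>
      ‖climit a k z * q ^ j * g z (climit a k z * q ^ j)‖)
    (h2 : Summable fun j : ℕ =>
      ‖climit a k z * q ^ j * g (q * z) (climit a k z * q ^ j)‖) :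
    (jackF q a k g z - jackF q a k g (q * z)) / ((1 - q) * z)
      = (1 - q) * (∑' j : ℕ, climit a k z * q ^ j *
            ((g z (climit a k z * q ^ j) - g (q * z) (climit a k z * q ^ j))
              / ((1 - q) * z)))
        - ∑ j ∈ Finset.range k,
            (q ^ ((j : ℤ) - (k : ℤ)) / (a * z ^ (k + 1))) *
              g (q * z) (q ^ ((j : ℤ) - (k : ℤ)) / (a * z ^ k)) := by
  have hq : q ≠ 0 := norm_pos_iff.mp hq0
  have hq' : 1 - q ≠ 0 := by
    rintro h
    rw [← sub_eq_zero.mp h, norm_one] at hq1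
    exact lt_irrefl _ hq1
  have hD : (∑' j : ℕ, climit a k z * q ^ j *
        ((g z (climit a k z * q ^ j) - g (q * z) (climit a k z * q ^ j)) / ((1 - q) * z))) =
      ((∑' j : ℕ, climit a k z * q ^ j * g z (climit a k z * q ^ j)) -
        ∑' j : ℕ, climit a k z * q ^ j * g (q * z) (climit a k z * q ^ j)) / ((1 - q) * z) := by
    rw [← h1.of_norm.tsum_sub h2.of_norm, ← tsum_div_const]
    exact tsum_congr fun j => by ring
  have hB : (∑ j ∈ Finset.range k, q ^ ((j : ℤ) - (k : ℤ)) / (a * z ^ (k + 1)) *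
        g (q * z) (q ^ ((j : ℤ) - (k : ℤ)) / (a * z ^ k))) =
      (∑ j ∈ Finset.range k, q ^ ((j : ℤ) - (k : ℤ)) / (a * z ^ k) *
        g (q * z) (q ^ ((j : ℤ) - (k : ℤ)) / (a * z ^ k))) / z := by
    rw [Finset.sum_div]
    refine Finset.sum_congr rfl fun j _ => ?_
    rw [pow_succ, ← mul_assoc, ← div_div]
    ring
  rw [hD, hB, jackF_mul hq a k g z h2.of_norm, jackF]
  field_simp
  ring

end
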